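/- Let β > 1 and x ∈ [0,1]. For 0 < a < 1, the lim inf of r_n(x,β)/n as n → ∞ equals a if and only if the uniform Diophantine exponent v̂_β(x) equals a/(1-a). Here r_n(x,β) is the maximal length of a block of consecutive zeros among the first n digits of the β-expansion of x, and v̂_β(x) is the supremum of real numbers v̂ such that for all sufficiently large N there exists 1 ≤ n ≤ N with T_β^n(x) ≤ β^{-v̂N}. -/

import Mathlib

open Filter MeasureTheory Set

noncomputable def betaT (β : ℝ) (x : ℝ) : ℝ := β * x - ⌊β * x⌋

noncomputable def eps (β x : ℝ) (n : ℕ) : ℤ := ⌊β * (betaT β)^[n - 1] x⌋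

noncomputable def runLen (β x : ℝ) (n : ℕ) : ℕ :=
  sSup {j | ∃ i, i + j ≤ n ∧ ∀ k < j, eps β x (i + k + 1) = 0}

def isAdmissible (β : ℝ) (n : ℕ) (ω : ℕ → ℤ) : Prop :=
  ∃ x ∈ Set.Ico (0 : ℝ) 1, ∀ k < n, eps β x (k + 1) = ω k

def cylinder (β : ℝ) (n : ℕ) (ω : ℕ → ℤ) : Set ℝ :=
  {x | x ∈ Set.Ico (0 : ℝ) 1 ∧ ∀ k < n, eps β x (k + 1) = ω k}

def isFull (β : ℝ) (n : ℕ) (ω : ℕ → ℤ) : Prop :=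
  MeasureTheory.volume (cylinder β n ω) = ENNReal.ofReal (β ^ (-(n : ℤ)))

open Classical in
noncomputable def epsStar (β : ℝ) : ℕ → ℤ :=
  if h : ∃ m, 1 ≤ m ∧ eps β 1 m ≠ 0 ∧ ∀ k, m < k → eps β 1 k = 0 then
    fun n =>
      if (n - 1) % Nat.find h + 1 = Nat.find h then eps β 1 (Nat.find h) - 1
      else eps β 1 ((n - 1) % Nat.find h + 1)
  else eps β 1

def lexLt (u v : ℕ → ℤ) : Prop := ∃ j, (∀ k < j, u k = v k) ∧ u j < v j

def lexLe (u v : ℕ → ℤ) : Prop := lexLt u v ∨ u = v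

noncomputable def vbeta (β x : ℝ) : ℝ :=
  sSup {v | 0 ≤ v ∧ ∃ᶠ n : ℕ in atTop, (betaT β)^[n] x ≤ β ^ (-((n : ℝ) * v))}

noncomputable def hatv (β x : ℝ) : ℝ :=
  sSup {v | 0 ≤ v ∧ ∀ᶠ N : ℕ in atTop, ∃ n, 1 ≤ n ∧ n ≤ N ∧ (betaT β)^[n] x ≤ β ^ (-(v * (N : ℝ)))}
lemma betaT_nonneg (β x : ℝ) : 0 ≤ betaT β x := Int.fract_nonneg (β * x)

lemma betaT_lt_one (β x : ℝ) : betaT β x < 1 := Int.fract_lt_one (β * x)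

lemma iterate_betaT_mem_Icc {β x : ℝ} (hx : x ∈ Icc (0 : ℝ) 1) (n : ℕ) :
    (betaT β)^[n] x ∈ Icc (0 : ℝ) 1 := by
  cases n with
  | zero => exact hx
  | succ n =>
    rw [Function.iterate_succ_apply']
    exact ⟨betaT_nonneg _ _, (betaT_lt_one _ _).le⟩

lemma iterate_betaT_succ (β x : ℝ) (n : ℕ) :
    (betaT β)^[n + 1] x = β * (betaT β)^[n] x - eps β x (n + 1) := by
  rw [Function.iterate_succ_apply']
  rfl

lemma iterate_betaT_add_of_eps_eq_zero {β x : ℝ} {i j : ℕ}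
    (h : ∀ k < j, eps β x (i + k + 1) = 0) :
    (betaT β)^[i + j] x = β ^ j * (betaT β)^[i] x := by
  induction j with
  | zero => simp
  | succ j ih =>
    rw [← add_assoc, iterate_betaT_succ, h j (by omega), ih fun k hk => h k (by omega)]
    push_cast
    ring

lemma iterate_betaT_le_of_eps_eq_zero {β x : ℝ} (hβ : 1 < β) (hx : x ∈ Icc (0 : ℝ) 1) {i j : ℕ}
    (h : ∀ k < j, eps β x (i + k + 1) = 0) :
    (betaT β)^[i] x ≤ β ^ (-(j : ℝ)) := by
  have h1 := (iterate_betaT_mem_Icc (β := β) hx (i + j)).2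
  rw [iterate_betaT_add_of_eps_eq_zero h] at h1
  have hp : 0 < β ^ j := by positivity
  rw [Real.rpow_neg (by positivity), Real.rpow_natCast, ← one_div, le_div_iff₀ hp]
  linarith

lemma eps_eq_zero_of_iterate_betaT_lt {β x : ℝ} (hβ : 1 < β) (hx : x ∈ Icc (0 : ℝ) 1) {i j : ℕ}
    (h : (betaT β)^[i] x < β ^ (-(j : ℝ))) :
    ∀ k < j, eps β x (i + k + 1) = 0 := by
  have hp : 0 < β ^ j := by positivity
  rw [Real.rpow_neg (by positivity), Real.rpow_natCast, ← one_div, lt_div_iff₀ hp] at h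
  have h0 := (iterate_betaT_mem_Icc (β := β) hx i).1
  intro k
  induction k using Nat.strong_induction_on with
  | _ k ih =>
    intro hk
    have e := iterate_betaT_add_of_eps_eq_zero (β := β) (x := x) (i := i) (j := k)
      fun l hl => ih l hl (hl.trans hk)
    unfold eps
    rw [Int.floor_eq_zero_iff, Nat.add_sub_cancel, e, ← mul_assoc, ← pow_succ']
    have hle : β ^ (k + 1) ≤ β ^ j := pow_le_pow_right₀ hβ.le hk
    exact ⟨by positivity, lt_of_le_of_lt (mul_le_mul_of_nonneg_right hle h0) (by linarith)⟩

lemma bddAbove_zero_blocks (β x : ℝ) (n : ℕ) :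
    BddAbove {j | ∃ i, i + j ≤ n ∧ ∀ k < j, eps β x (i + k + 1) = 0} :=
  ⟨n, by rintro j ⟨i, hi, -⟩; omega⟩

lemma exists_zero_block_runLen (β x : ℝ) (n : ℕ) :
    ∃ i, i + runLen β x n ≤ n ∧ ∀ k < runLen β x n, eps β x (i + k + 1) = 0 :=
  Nat.sSup_mem (s := {j | ∃ i, i + j ≤ n ∧ ∀ k < j, eps β x (i + k + 1) = 0})
    ⟨0, 0, by simp⟩ (bddAbove_zero_blocks β x n)

lemma le_runLen {β x : ℝ} {n i j : ℕ} (hij : i + j ≤ n)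
    (h : ∀ k < j, eps β x (i + k + 1) = 0) : j ≤ runLen β x n :=
  le_csSup (bddAbove_zero_blocks β x n) ⟨i, hij, h⟩

lemma runLen_le (β x : ℝ) (n : ℕ) : runLen β x n ≤ n := by
  obtain ⟨i, hi, -⟩ := exists_zero_block_runLen β x n
  omega

lemma runLen_div_le_one (β x : ℝ) (n : ℕ) : (runLen β x n : ℝ) / n ≤ 1 :=
  div_le_one_of_le₀ (by exact_mod_cast runLen_le β x n) (by positivity)

lemma isBoundedUnder_ge_runLen_div (β x : ℝ) :
    IsBoundedUnder (· ≥ ·) atTop fun n : ℕ => (runLen β x n : ℝ) / n :=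
  isBoundedUnder_of ⟨0, fun n => by positivity⟩

lemma isCoboundedUnder_ge_runLen_div (β x : ℝ) :
    IsCoboundedUnder (· ≥ ·) atTop fun n : ℕ => (runLen β x n : ℝ) / n :=
  (isBoundedUnder_of (r := (· ≤ ·)) ⟨1, runLen_div_le_one β x⟩).isCoboundedUnder_ge

lemma liminf_runLen_div_nonneg (β x : ℝ) :
    0 ≤ liminf (fun n : ℕ => (runLen β x n : ℝ) / n) atTop :=
  le_liminf_of_le (isCoboundedUnder_ge_runLen_div β x)
    (Eventually.of_forall fun n => by positivity)

/-- An exponent `v` is uniformly attained by the `β`-expansion of `x` when the inequality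
defining `hatv β x` is solvable for all large `N`. -/
def uniformExponents (β x : ℝ) : Set ℝ :=
  {v | 0 ≤ v ∧ ∀ᶠ N : ℕ in atTop,
    ∃ n, 1 ≤ n ∧ n ≤ N ∧ (betaT β)^[n] x ≤ β ^ (-(v * (N : ℝ)))}

lemma div_one_add_le_liminf_runLen_div {β x v : ℝ} (hβ : 1 < β) (hx : x ∈ Icc (0 : ℝ) 1)
    (hv : v ∈ uniformExponents β x) :
    v / (1 + v) ≤ liminf (fun n : ℕ => (runLen β x n : ℝ) / n) atTop := by
  obtain ⟨hv0, hv⟩ := hv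
  rcases hv0.eq_or_lt with rfl | hv0
  · simpa using liminf_runLen_div_nonneg β x
  refine le_of_forall_lt_imp_le_of_dense fun c hc => ?_
  refine le_liminf_of_le (isCoboundedUnder_ge_runLen_div β x) ?_
  have hfloor : Tendsto (fun m : ℕ => ⌊(m : ℝ) / (1 + v)⌋₊) atTop atTop :=
    tendsto_nat_floor_atTop.comp
      (tendsto_natCast_atTop_atTop.atTop_div_const (by positivity))
  have hlin : Tendsto (fun m : ℕ => (v / (1 + v) - c) * (m : ℝ)) atTop atTop :=
    tendsto_natCast_atTop_atTop.const_mul_atTop (by linarith)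
  filter_upwards [hfloor.eventually hv, hfloor.eventually_ge_atTop 1, eventually_ge_atTop 1,
    hlin.eventually_ge_atTop (v + 1)] with m ⟨n, _, hnN, hn⟩ hN1 hm hlarge
  set N := ⌊(m : ℝ) / (1 + v)⌋₊ with hN
  have hN1' : (1 : ℝ) ≤ N := by exact_mod_cast hN1
  have hvN : 0 < v * N := by positivity
  obtain ⟨j, hj⟩ : ∃ j, ⌈v * (N : ℝ)⌉₊ = j + 1 :=
    Nat.exists_eq_succ_of_ne_zero (Nat.ceil_pos.2 hvN).ne'
  have hj1 : (j : ℝ) < v * N := Nat.lt_ceil.1 (by omega)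
  have hj2 : v * (N : ℝ) ≤ j + 1 := by
    have := Nat.le_ceil (v * (N : ℝ))
    rw [hj] at this
    exact_mod_cast this
  have hle : (N : ℝ) * (1 + v) ≤ m :=
    (le_div_iff₀ (by positivity)).1 (Nat.floor_le (by positivity))
  have hlt : (m : ℝ) / (1 + v) < N + 1 := Nat.lt_floor_add_one _
  have hsum : n + j ≤ m := by
    have : (n : ℝ) ≤ N := by exact_mod_cast hnN
    have : (n : ℝ) + j ≤ m := by linarith
    exact_mod_cast this
  have hr : (j : ℝ) ≤ runLen β x m := by
    exact_mod_cast le_runLen hsum (eps_eq_zero_of_iterate_betaT_lt hβ hx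
      (hn.trans_lt (Real.rpow_lt_rpow_of_exponent_lt hβ (by linarith))))
  have hm0 : (0 : ℝ) < m := by exact_mod_cast hm
  rw [le_div_iff₀ hm0]
  have hmul : v * ((m : ℝ) / (1 + v)) ≤ v * (N + 1) :=
    mul_le_mul_of_nonneg_left hlt.le hv0.le
  have hcomm : v / (1 + v) * m = v * ((m : ℝ) / (1 + v)) := by ring
  rw [sub_mul, hcomm] at hlarge
  linarith

lemma mem_uniformExponents_of_lt_liminf {β x c v : ℝ} (hβ : 1 < β) (hx : x ∈ Icc (0 : ℝ) 1)
    (hc0 : 0 ≤ c) (hc1 : c < 1)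
    (hc : c < liminf (fun n : ℕ => (runLen β x n : ℝ) / n) atTop)
    (hv0 : 0 ≤ v) (hv : v < c / (1 - c)) : v ∈ uniformExponents β x := by
  refine ⟨hv0, ?_⟩
  have hc' : 0 < 1 - c := by linarith
  have hfloor : Tendsto (fun N : ℕ => ⌊(N : ℝ) / (1 - c)⌋₊) atTop atTop :=
    tendsto_nat_floor_atTop.comp
      (tendsto_natCast_atTop_atTop.atTop_div_const hc')
  have hlin : Tendsto (fun N : ℕ => (c / (1 - c) - v) * (N : ℝ)) atTop atTop :=
    tendsto_natCast_atTop_atTop.const_mul_atTop (by linarith)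
  filter_upwards [hfloor.eventually
      (eventually_lt_of_lt_liminf hc (isBoundedUnder_ge_runLen_div β x)),
    hfloor.eventually_ge_atTop 1, eventually_ge_atTop 1,
    hlin.eventually_ge_atTop 2] with N hr hm hN hlarge
  set m := ⌊(N : ℝ) / (1 - c)⌋₊ with hmdef
  have hm0 : (0 : ℝ) < m := by exact_mod_cast hm
  rw [lt_div_iff₀ hm0] at hr
  obtain ⟨i, hi, hblock⟩ := exists_zero_block_runLen β x m
  set j := runLen β x m
  have hi' : (i : ℝ) + j ≤ m := by exact_mod_cast hi
  have hle : (m : ℝ) * (1 - c) ≤ N :=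
    (le_div_iff₀ hc').1 (Nat.floor_le (by positivity))
  have hlt : (N : ℝ) / (1 - c) < m + 1 := Nat.lt_floor_add_one _
  have hiN : i ≤ N := by
    have : (i : ℝ) ≤ N := by linarith
    exact_mod_cast this
  have hmul : c * ((N : ℝ) / (1 - c)) ≤ c * (m + 1) := mul_le_mul_of_nonneg_left hlt.le hc0
  have hcomm : c / (1 - c) * N = c * ((N : ℝ) / (1 - c)) := by ring
  rw [sub_mul, hcomm] at hlarge
  have hj : v * N + 1 ≤ j := by linarith
  have hvN : 0 ≤ v * N := by positivity
  rcases Nat.eq_zero_or_pos i with rfl | hi0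
  · obtain ⟨l, hl⟩ : ∃ l, j = l + 1 := by
      refine Nat.exists_eq_succ_of_ne_zero fun h0 => ?_
      rw [h0] at hj
      norm_num at hj
      linarith
    refine ⟨1, le_rfl, hN, (iterate_betaT_le_of_eps_eq_zero hβ hx (j := l) fun k hk => ?_).trans
      (Real.rpow_le_rpow_of_exponent_le hβ.le ?_)⟩
    · have := hblock (k + 1) (by omega)
      rwa [show 0 + (k + 1) + 1 = 1 + k + 1 by omega] at this
    · rw [hl] at hj
      push_cast at hj
      linarith
  · exact ⟨i, hi0, hiN, (iterate_betaT_le_of_eps_eq_zero hβ hx hblock).trans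
      (Real.rpow_le_rpow_of_exponent_le hβ.le (by linarith))⟩

lemma lt_div_one_sub_iff {v c : ℝ} (hv : 0 ≤ v) (hc : c < 1) :
    v < c / (1 - c) ↔ v / (1 + v) < c := by
  rw [lt_div_iff₀ (by linarith), div_lt_iff₀ (by linarith)]
  constructor <;> intro h <;> linarith

lemma mem_uniformExponents_of_div_lt {β x v : ℝ} (hβ : 1 < β) (hx : x ∈ Icc (0 : ℝ) 1)
    (hv0 : 0 ≤ v)
    (hv : v / (1 + v) < liminf (fun n : ℕ => (runLen β x n : ℝ) / n) atTop) :
    v ∈ uniformExponents β x := by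
  have hv1 : v / (1 + v) < 1 := (div_lt_one (by linarith)).2 (by linarith)
  obtain ⟨c, hc, hc'⟩ := exists_between (lt_min hv hv1)
  have hc1 : c < 1 := hc'.trans_le (min_le_right _ _)
  exact mem_uniformExponents_of_lt_liminf hβ hx ((by positivity : 0 ≤ v / (1 + v)).trans hc.le)
    hc1 (hc'.trans_le (min_le_left _ _)) hv0 ((lt_div_one_sub_iff hv0 hc1).2 hc)

lemma le_div_one_sub_liminf {β x v : ℝ} (hβ : 1 < β) (hx : x ∈ Icc (0 : ℝ) 1)
    (hL : liminf (fun n : ℕ => (runLen β x n : ℝ) / n) atTop < 1)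
    (hv : v ∈ uniformExponents β x) :
    v ≤ liminf (fun n : ℕ => (runLen β x n : ℝ) / n) atTop /
      (1 - liminf (fun n : ℕ => (runLen β x n : ℝ) / n) atTop) := by
  have h := div_one_add_le_liminf_runLen_div hβ hx hv
  have hv0 := hv.1
  rw [div_le_iff₀ (by linarith)] at h
  rw [le_div_iff₀ (by linarith)]
  linarith

lemma hatv_eq_div_one_sub_liminf {β x : ℝ} (hβ : 1 < β) (hx : x ∈ Icc (0 : ℝ) 1)
    (hL : liminf (fun n : ℕ => (runLen β x n : ℝ) / n) atTop < 1) :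
    hatv β x = liminf (fun n : ℕ => (runLen β x n : ℝ) / n) atTop /
      (1 - liminf (fun n : ℕ => (runLen β x n : ℝ) / n) atTop) := by
  have hub := fun v => le_div_one_sub_liminf (v := v) hβ hx hL
  have hmem := fun v => mem_uniformExponents_of_div_lt (v := v) hβ hx
  have hL0 := liminf_runLen_div_nonneg β x
  set L := liminf (fun n : ℕ => (runLen β x n : ℝ) / n) atTop
  have hq : 0 ≤ L / (1 - L) := div_nonneg hL0 (by linarith)
  change sSup (uniformExponents β x) = _
  refine le_antisymm (Real.sSup_le hub hq) (le_of_forall_lt_imp_le_of_dense fun w hw => ?_)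
  rcases lt_or_ge w 0 with hw0 | hw0
  · exact hw0.le.trans (Real.sSup_nonneg fun v hv => hv.1)
  · exact le_csSup ⟨_, hub⟩ (hmem w hw0 ((lt_div_one_sub_iff hw0 hL).1 hw))

lemma hatv_eq_zero_of_one_le_liminf {β x : ℝ} (hβ : 1 < β) (hx : x ∈ Icc (0 : ℝ) 1)
    (hL : 1 ≤ liminf (fun n : ℕ => (runLen β x n : ℝ) / n) atTop) : hatv β x = 0 := by
  refine Real.sSup_of_not_bddAbove fun ⟨b, hb⟩ => ?_
  have hb0 : 0 ≤ |b| + 1 := by positivity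
  have hmem : |b| + 1 ∈ uniformExponents β x :=
    mem_uniformExponents_of_div_lt hβ hx hb0
      (((div_lt_one (by linarith)).2 (by linarith)).trans_le hL)
  linarith [hb hmem, le_abs_self b]

theorem stmt5 (β : ℝ) (hβ : 1 < β) (x : ℝ) (hx : x ∈ Set.Icc (0 : ℝ) 1)
    (a : ℝ) (ha0 : 0 < a) (ha1 : a < 1) :
    Filter.liminf (fun n : ℕ => (runLen β x n : ℝ) / n) Filter.atTop = a ↔
      hatv β x = a / (1 - a) := by
  rcases lt_or_ge (liminf (fun n : ℕ => (runLen β x n : ℝ) / n) atTop) 1 with hL | hL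
  · rw [hatv_eq_div_one_sub_liminf hβ hx hL, div_eq_div_iff (by linarith) (by linarith)]
    constructor <;> intro h <;> linarith
  · rw [hatv_eq_zero_of_one_le_liminf hβ hx hL]
    have hq : 0 < a / (1 - a) := div_pos ha0 (by linarith)
    constructor <;> intro h <;> linarith
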